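/- There exists an infinite real matrix A with A ∈ (c₀(Z), c₀(Z)) but A ∉ (c₀(Z) ∩ ℓ∞, c₀(Z) ∩ ℓ∞); explicitly, the diagonal matrix with a_{n,n} = n when n is a perfect square, a_{n,n} = 1 when n is not a perfect square, and a_{n,k} = 0 for n ≠ k, maps every sequence with Z-limit 0 to a sequence with Z-limit 0, yet maps the (bounded) indicator sequence of the set of perfect squares to an unbounded sequence. In particular, condition (T1) sup_n ∑_k |a_{n,k}| < ∞ is not necessary for membership in (c₀(Z), c₀(Z)). -/

import Mathlib

open Filter Topology

/-- `x ∈ ℓ∞`: `x` is a bounded real sequence. -/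
def Bdd (x : ℕ → ℝ) : Prop := ∃ C : ℝ, ∀ n, |x n| ≤ C

/-- An admissible ideal on `ℕ`: a family of subsets of `ℕ` closed under taking
subsets and finite unions, containing every finite set, and not containing `ℕ`. -/
def IsAdmissibleIdeal (I : Set (Set ℕ)) : Prop :=
  (∀ A ∈ I, ∀ B ⊆ A, B ∈ I) ∧
  (∀ A ∈ I, ∀ B ∈ I, A ∪ B ∈ I) ∧
  (∀ A : Set ℕ, A.Finite → A ∈ I) ∧
  (Set.univ : Set ℕ) ∉ I

/-- `I`-convergence of the sequence `x` to `η`. -/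
def IdealLim (I : Set (Set ℕ)) (x : ℕ → ℝ) (η : ℝ) : Prop :=
  ∀ ε : ℝ, 0 < ε → {n : ℕ | ε < |x n - η|} ∈ I

/-- `(Ax)ₙ = ∑ₖ a n k * x k`. -/
noncomputable def matMul (a : ℕ → ℕ → ℝ) (x : ℕ → ℝ) : ℕ → ℝ :=
  fun n => ∑' k, a n k * x k

/-- Condition (T1): `sup_n ∑ₖ |a n k| < ∞`. -/
def CondT1 (a : ℕ → ℕ → ℝ) : Prop :=
  ∃ C : ℝ, ∀ n : ℕ, ∀ F : Finset ℕ, ∑ k ∈ F, |a n k| ≤ C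

/-- Condition (T2): the rows of `a` are summable and `J-lim_n ∑ₖ a n k = 1`. -/
def CondT2 (J : Set (Set ℕ)) (a : ℕ → ℕ → ℝ) : Prop :=
  (∀ n, Summable (a n)) ∧ IdealLim J (fun n => ∑' k, a n k) 1

/-- Condition (T3): `J-lim_n ∑_{k ∈ E} |a n k| = 0` for every `E ∈ I`. -/
def CondT3 (I J : Set (Set ℕ)) (a : ℕ → ℕ → ℝ) : Prop :=
  ∀ E ∈ I, IdealLim J (fun n => ∑' k, E.indicator (fun j => |a n j|) k) 0

/-- `A` is `(I, J)`-regular: `A` maps every bounded `I`-convergent sequence to a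
(well-defined) bounded `J`-convergent sequence and preserves the ideal limits. -/
def IJRegular (I J : Set (Set ℕ)) (a : ℕ → ℕ → ℝ) : Prop :=
  ∀ x : ℕ → ℝ, Bdd x → ∀ η : ℝ, IdealLim I x η →
    (∀ n, Summable fun k => a n k * x k) ∧ Bdd (matMul a x) ∧
      IdealLim J (matMul a x) η

/-- The ideal `Z` of sets of asymptotic density zero. -/
def densityZeroIdeal : Set (Set ℕ) :=
  {S : Set ℕ | Tendsto
    (fun n : ℕ => (∑ k ∈ Finset.Icc 1 n, S.indicator (fun _ => (1 : ℝ)) k) / n)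
    atTop (𝓝 0)}

open scoped Classical

/-- The diagonal matrix with `a n n = n` when `n` is a perfect square,
`a n n = 1` when `n` is not a perfect square, and `a n k = 0` for `n ≠ k`. -/
noncomputable def sqDiagMatrix : ℕ → ℕ → ℝ :=
  fun n k => if n = k then (if IsSquare n then (n : ℝ) else 1) else 0

theorem densityZeroIdeal_mono {S T : Set ℕ} (hT : T ∈ densityZeroIdeal) (hST : S ⊆ T) :
    S ∈ densityZeroIdeal := by
  refine squeeze_zero (fun n => ?_) (fun n => ?_) hT
  · exact div_nonneg (Finset.sum_nonneg fun k _ =>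
      Set.indicator_nonneg (fun _ _ => zero_le_one) k) n.cast_nonneg
  · gcongr

theorem densityZeroIdeal_union {S T : Set ℕ} (hS : S ∈ densityZeroIdeal)
    (hT : T ∈ densityZeroIdeal) : S ∪ T ∈ densityZeroIdeal := by
  have hsum := Tendsto.add hS hT
  rw [add_zero] at hsum
  refine squeeze_zero (fun n => ?_) (fun n => ?_) hsum
  · exact div_nonneg (Finset.sum_nonneg fun k _ =>
      Set.indicator_nonneg (fun _ _ => zero_le_one) k) n.cast_nonneg
  · rw [← add_div, ← Finset.sum_add_distrib]
    gcongr with k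
    by_cases h₁ : k ∈ S <;> by_cases h₂ : k ∈ T <;> simp [h₁, h₂]

theorem card_isSquare_Icc_le_sqrt (n : ℕ) :
    ((Finset.Icc 1 n).filter fun k => IsSquare k).card ≤ n.sqrt := by
  calc _ ≤ ((Finset.Icc 1 n.sqrt).image fun k => k * k).card := by
        refine Finset.card_le_card fun k hk => ?_
        simp only [Finset.mem_filter, Finset.mem_Icc, Finset.mem_image] at hk ⊢
        obtain ⟨⟨h₁, h₂⟩, r, rfl⟩ := hk
        exact ⟨r, ⟨Nat.pos_of_mul_pos_left h₁, Nat.le_sqrt.2 h₂⟩, rfl⟩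
    _ ≤ (Finset.Icc 1 n.sqrt).card := Finset.card_image_le
    _ = n.sqrt := by simp

theorem setOf_isSquare_mem_densityZeroIdeal : {m : ℕ | IsSquare m} ∈ densityZeroIdeal := by
  have hlim : Tendsto (fun n : ℕ => (√(n : ℝ))⁻¹) atTop (𝓝 0) :=
    (Real.tendsto_sqrt_atTop.comp tendsto_natCast_atTop_atTop).inv_tendsto_atTop
  refine squeeze_zero (fun n => ?_) (fun n => ?_) hlim
  · exact div_nonneg (Finset.sum_nonneg fun k _ =>
      Set.indicator_nonneg (fun _ _ => zero_le_one) k) n.cast_nonneg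
  · rw [← Real.sqrt_div_self]
    gcongr
    calc _ = (((Finset.Icc 1 n).filter fun k => IsSquare k).card : ℝ) := by
          simp [Set.indicator_apply]
      _ ≤ (n.sqrt : ℝ) := by exact_mod_cast card_isSquare_Icc_le_sqrt n
      _ ≤ √(n : ℝ) := Real.nat_sqrt_le_real_sqrt

theorem sqDiagMatrix_mul_eq_zero (x : ℕ → ℝ) {n k : ℕ} (h : k ≠ n) :
    sqDiagMatrix n k * x k = 0 := by
  simp [sqDiagMatrix, h.symm]

theorem summable_sqDiagMatrix_mul (x : ℕ → ℝ) (n : ℕ) :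
    Summable fun k => sqDiagMatrix n k * x k :=
  (hasSum_single n fun _ h => sqDiagMatrix_mul_eq_zero x h).summable

theorem matMul_sqDiagMatrix (x : ℕ → ℝ) (n : ℕ) :
    matMul sqDiagMatrix x n = (if IsSquare n then (n : ℝ) else 1) * x n := by
  rw [matMul, tsum_eq_single n fun _ h => sqDiagMatrix_mul_eq_zero x h]
  simp [sqDiagMatrix]

theorem idealLim_matMul_sqDiagMatrix {x : ℕ → ℝ} (hx : IdealLim densityZeroIdeal x 0) :
    IdealLim densityZeroIdeal (matMul sqDiagMatrix x) 0 := by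
  intro ε hε
  refine densityZeroIdeal_mono
    (densityZeroIdeal_union (hx ε hε) setOf_isSquare_mem_densityZeroIdeal) fun n hn => ?_
  by_cases h : IsSquare n
  · exact Or.inr h
  · refine Or.inl ?_
    simpa [matMul_sqDiagMatrix, h] using hn

theorem exists_isSquare_cast_gt (C : ℝ) : ∃ n : ℕ, IsSquare n ∧ C < n := by
  obtain ⟨m, hm⟩ := exists_nat_gt C
  exact ⟨m * m, ⟨m, rfl⟩, hm.trans_le (by exact_mod_cast Nat.le_mul_self m)⟩

theorem bdd_indicator_one (S : Set ℕ) : Bdd fun n => S.indicator (fun _ => (1 : ℝ)) n :=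
  ⟨1, fun n => by by_cases h : n ∈ S <;> simp [h]⟩

theorem idealLim_indicator_isSquare :
    IdealLim densityZeroIdeal
      (fun n => ({m : ℕ | IsSquare m}).indicator (fun _ => (1 : ℝ)) n) 0 := by
  intro ε hε
  refine densityZeroIdeal_mono setOf_isSquare_mem_densityZeroIdeal fun n hn => ?_
  by_contra h
  have hlt : ε < |({m : ℕ | IsSquare m}).indicator (fun _ => (1 : ℝ)) n - 0| := hn
  rw [Set.indicator_of_notMem h] at hlt
  simp [hε.not_gt] at hlt

theorem not_bdd_matMul_sqDiagMatrix_indicator :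
    ¬ Bdd (matMul sqDiagMatrix
      (fun n => ({m : ℕ | IsSquare m}).indicator (fun _ => (1 : ℝ)) n)) := by
  rintro ⟨C, hC⟩
  obtain ⟨n, hsq, hn⟩ := exists_isSquare_cast_gt C
  have h := hC n
  simp only [matMul_sqDiagMatrix, if_pos hsq,
    Set.indicator_of_mem (show n ∈ {m : ℕ | IsSquare m} from hsq), mul_one,
    Nat.abs_cast] at h
  exact hn.not_ge h

theorem not_condT1_sqDiagMatrix : ¬ CondT1 sqDiagMatrix := by
  rintro ⟨C, hC⟩
  obtain ⟨n, hsq, hn⟩ := exists_isSquare_cast_gt C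
  have h := hC n {n}
  simp only [Finset.sum_singleton, sqDiagMatrix, if_true, if_pos hsq, Nat.abs_cast] at h
  exact hn.not_ge h

/-- There is a matrix in `(c₀(Z), c₀(Z))` which is not in
`(c₀(Z) ∩ ℓ∞, c₀(Z) ∩ ℓ∞)`: the diagonal matrix `sqDiagMatrix` maps every
sequence with `Z`-limit `0` to a sequence with `Z`-limit `0`, yet it maps the
bounded indicator sequence of the set of perfect squares (which has `Z`-limit
`0`) to an unbounded sequence; in particular it fails condition (T1), so (T1)
is not necessary for membership in `(c₀(Z), c₀(Z))`. -/
theorem c0Z_c0Z_not_bounded :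
    (∀ x : ℕ → ℝ, IdealLim densityZeroIdeal x 0 →
      (∀ n, Summable fun k => sqDiagMatrix n k * x k) ∧
        IdealLim densityZeroIdeal (matMul sqDiagMatrix x) 0) ∧
    (Bdd (fun n => ({m : ℕ | IsSquare m}).indicator (fun _ => (1 : ℝ)) n) ∧
      IdealLim densityZeroIdeal
        (fun n => ({m : ℕ | IsSquare m}).indicator (fun _ => (1 : ℝ)) n) 0 ∧
      ¬ Bdd (matMul sqDiagMatrix
        (fun n => ({m : ℕ | IsSquare m}).indicator (fun _ => (1 : ℝ)) n))) ∧
    ¬ (∀ x : ℕ → ℝ, Bdd x → IdealLim densityZeroIdeal x 0 →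
        Bdd (matMul sqDiagMatrix x) ∧
          IdealLim densityZeroIdeal (matMul sqDiagMatrix x) 0) ∧
    ¬ CondT1 sqDiagMatrix := by
  refine ⟨fun x hx => ⟨summable_sqDiagMatrix_mul x, idealLim_matMul_sqDiagMatrix hx⟩,
    ⟨bdd_indicator_one _, idealLim_indicator_isSquare, not_bdd_matMul_sqDiagMatrix_indicator⟩,
    fun h => ?_, not_condT1_sqDiagMatrix⟩
  exact not_bdd_matMul_sqDiagMatrix_indicator
    (h _ (bdd_indicator_one _) idealLim_indicator_isSquare).1
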